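/- Let θ₀ ∈ L²(0,1) and let θ₀^odd denote its odd extension to ℝ (equal to θ₀(x) on (0,1), to −θ₀(−x) on (−1,0), and to 0 outside (−1,1)). Define E(t,x) := e^{i x²/(4t)} / √(4π i t) for t ≠ 0, and θ⁻(t,x) := ∫_{−1}^{1} E(t, x−y) θ₀^odd(y) dy. Then for every t > 0 and every x ∈ [0,1] one has the convergent expansion θ⁻(t,x) = Σ_{j≥0} (−i)^j x^{2j+1}/(2j+1)! · ∂_t^j (∂_x θ⁻)(t,0). -/

import Mathlib

open MeasureTheory Complex Real Set Filter

/-- The fundamental solution `E(t,x) = e^{i x²/(4t)} / √(4π i t)` of the 1D Schrödinger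
equation, the complex square root being the principal branch. -/
noncomputable def E (t x : ℝ) : ℂ :=
  Complex.exp (Complex.I * (x : ℂ) ^ 2 / (4 * (t : ℂ))) /
    ((4 * (Real.pi : ℂ) * Complex.I * (t : ℂ)) ^ ((1 : ℂ) / 2))

/-- The odd extension of `θ₀ : (0,1) → ℂ` to `ℝ`. -/
noncomputable def thetaOdd (θ₀ : ℝ → ℂ) (x : ℝ) : ℂ :=
  if 0 < x ∧ x < 1 then θ₀ x else if -1 < x ∧ x < 0 then -θ₀ (-x) else 0

/-- `θ⁻(t,x) = ∫_{-1}^1 E(t, x-y) θ₀^odd(y) dy`. -/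
noncomputable def thetaMinus (θ₀ : ℝ → ℂ) (t x : ℝ) : ℂ :=
  ∫ y in Set.Ioo (-1 : ℝ) 1, E t (x - y) * thetaOdd θ₀ y

/-- The `n`-th spatial derivative of the Schrödinger kernel `E`, at complex space points. -/
noncomputable def schrodingerKernelDeriv : ℕ → ℝ → ℂ → ℂ
  | 0, t, z => Complex.exp (Complex.I * z ^ 2 / (4 * (t : ℂ))) /
      ((4 * (Real.pi : ℂ) * Complex.I * (t : ℂ)) ^ ((1 : ℂ) / 2))
  | 1, t, z => Complex.I / (2 * (t : ℂ)) * (z * schrodingerKernelDeriv 0 t z)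
  | n + 2, t, z => Complex.I / (2 * (t : ℂ)) *
      (z * schrodingerKernelDeriv (n + 1) t z + (n + 1) * schrodingerKernelDeriv n t z)

lemma schrodingerKernelDeriv_zero_ofReal (t x : ℝ) :
    schrodingerKernelDeriv 0 t x = E t x := by
  simp only [schrodingerKernelDeriv, E]

lemma schrodingerKernelDeriv_neg (n : ℕ) (t : ℝ) (z : ℂ) :
    schrodingerKernelDeriv n t (-z) = (-1) ^ n * schrodingerKernelDeriv n t z := by
  induction n using Nat.twoStepInduction with
  | zero => simp [schrodingerKernelDeriv]
  | one => simp [schrodingerKernelDeriv]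
  | more n ih₀ ih₁ =>
    simp only [schrodingerKernelDeriv, ih₀, ih₁]
    ring

lemma hasDerivAt_schrodingerKernelDeriv_space {t : ℝ} (ht : 0 < t) (n : ℕ) (z : ℂ) :
    HasDerivAt (schrodingerKernelDeriv n t) (schrodingerKernelDeriv (n + 1) t z) z := by
  have ht' : (t : ℂ) ≠ 0 := by exact_mod_cast ht.ne'
  have hzero : HasDerivAt (schrodingerKernelDeriv 0 t) (schrodingerKernelDeriv 1 t z) z := by
    have h : HasDerivAt (fun z : ℂ => Complex.I * z ^ 2 / (4 * (t : ℂ)))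
        (Complex.I * (2 * z) / (4 * (t : ℂ))) z := by
      simpa using ((hasDerivAt_pow 2 z).const_mul Complex.I).div_const (4 * (t : ℂ))
    refine (h.cexp.div_const
      ((4 * (Real.pi : ℂ) * Complex.I * (t : ℂ)) ^ ((1 : ℂ) / 2))).congr_deriv ?_
    simp only [schrodingerKernelDeriv]
    field_simp
    ring
  induction n using Nat.twoStepInduction with
  | zero => exact hzero
  | one =>
    refine (((hasDerivAt_id z).fun_mul hzero).const_mul (Complex.I / (2 * (t : ℂ)))).congr_deriv ?_
    simp only [schrodingerKernelDeriv, id]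
    push_cast
    ring
  | more n ih₀ ih₁ =>
    refine ((((hasDerivAt_id z).fun_mul ih₁).fun_add (ih₀.const_mul ((n : ℂ) + 1))).const_mul
      (Complex.I / (2 * (t : ℂ)))).congr_deriv ?_
    simp only [schrodingerKernelDeriv, id]
    push_cast
    ring

lemma four_pi_I_mul_mem_slitPlane {t : ℝ} (ht : 0 < t) :
    4 * (Real.pi : ℂ) * Complex.I * (t : ℂ) ∈ Complex.slitPlane := by
  refine Complex.mem_slitPlane_iff.mpr (Or.inr ?_)
  simp [ht.ne', Real.pi_ne_zero]

/-- The time derivatives of the kernel follow the Schrödinger equation `∂_t = i ∂_x²`. -/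
lemma hasDerivAt_schrodingerKernelDeriv_time {t : ℝ} (ht : 0 < t) (n : ℕ) (z : ℂ) :
    HasDerivAt (fun s => schrodingerKernelDeriv n s z)
      (Complex.I * schrodingerKernelDeriv (n + 2) t z) t := by
  have ht' : (t : ℂ) ≠ 0 := by exact_mod_cast ht.ne'
  have hcoef : HasDerivAt (fun s : ℝ => Complex.I / (2 * (s : ℂ)))
      (-(1 / (t : ℂ)) * (Complex.I / (2 * (t : ℂ)))) t := by
    refine ((hasDerivAt_const (t : ℂ) Complex.I).fun_div
      ((hasDerivAt_id (t : ℂ)).const_mul 2) (by simpa using ht')).comp_ofReal.congr_deriv ?_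
    simp only [id]
    field_simp
    ring
  have hzero : HasDerivAt (fun s => schrodingerKernelDeriv 0 s z)
      (Complex.I * schrodingerKernelDeriv 2 t z) t := by
    have hslit := four_pi_I_mul_mem_slitPlane ht
    have hne := Complex.slitPlane_ne_zero hslit
    have hexp := ((hasDerivAt_const (t : ℂ) (Complex.I * z ^ 2)).fun_div
      ((hasDerivAt_id (t : ℂ)).const_mul 4) (by simpa using ht')).cexp
    have hroot := ((hasDerivAt_id (t : ℂ)).const_mul
      (4 * (Real.pi : ℂ) * Complex.I)).cpow_const (c := (1 : ℂ) / 2) (by simpa using hslit)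
    have hroot_ne : (4 * (Real.pi : ℂ) * Complex.I * (t : ℂ)) ^ ((1 : ℂ) / 2) ≠ 0 := by
      simp [Complex.cpow_eq_zero_iff, hne]
    refine (hexp.fun_div hroot hroot_ne).comp_ofReal.congr_deriv ?_
    simp only [schrodingerKernelDeriv, id, Complex.cpow_sub _ _ hne, Complex.cpow_one]
    set r := (4 * (Real.pi : ℂ) * Complex.I * (t : ℂ)) ^ ((1 : ℂ) / 2)
    have hpi : (Real.pi : ℂ) ≠ 0 := by exact_mod_cast Real.pi_ne_zero
    field_simp
    ring_nf
    simp only [Complex.I_sq, Complex.I_pow_three]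
    ring
  induction n using Nat.twoStepInduction with
  | zero => exact hzero
  | one =>
    refine (hcoef.fun_mul (hzero.const_mul z)).congr_deriv ?_
    simp only [schrodingerKernelDeriv]
    push_cast
    field_simp
    ring_nf
    simp only [Complex.I_sq, Complex.I_pow_three]
    ring
  | more n ih₀ ih₁ =>
    refine (hcoef.fun_mul ((ih₁.const_mul z).fun_add
      (ih₀.const_mul ((n : ℂ) + 1)))).congr_deriv ?_
    rw [schrodingerKernelDeriv.eq_3 t z (n + 2)]
    push_cast
    linear_combination (1 / (t : ℂ)) * schrodingerKernelDeriv.eq_3 t z n -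
      schrodingerKernelDeriv (n + 2) t z / t * Complex.I_sq

lemma continuousOn_schrodingerKernelDeriv (n : ℕ) :
    ContinuousOn (fun p : ℝ × ℂ => schrodingerKernelDeriv n p.1 p.2) (Ioi 0 ×ˢ univ) := by
  have hne : ∀ p ∈ (Ioi 0 ×ˢ univ : Set (ℝ × ℂ)), (p.1 : ℂ) ≠ 0 := by
    rintro ⟨t, z⟩ ⟨ht, -⟩
    exact_mod_cast (mem_Ioi.mp ht).ne'
  have hcoef : ContinuousOn (fun p : ℝ × ℂ => Complex.I / (2 * (p.1 : ℂ)))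
      (Ioi 0 ×ˢ univ) :=
    ContinuousOn.div (by fun_prop) (by fun_prop) fun p hp => by simpa using hne p hp
  have hzero : ContinuousOn (fun p : ℝ × ℂ => schrodingerKernelDeriv 0 p.1 p.2)
      (Ioi 0 ×ˢ univ) := by
    simp only [schrodingerKernelDeriv]
    refine ContinuousOn.div (ContinuousOn.cexp (ContinuousOn.div (by fun_prop) (by fun_prop)
      fun p hp => by simpa using hne p hp)) (ContinuousOn.cpow_const (by fun_prop)
      fun p hp => four_pi_I_mul_mem_slitPlane hp.1) fun p hp => ?_
    simp [Complex.cpow_eq_zero_iff,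
      Complex.slitPlane_ne_zero (four_pi_I_mul_mem_slitPlane hp.1)]
  induction n using Nat.twoStepInduction with
  | zero => exact hzero
  | one =>
    simp only [schrodingerKernelDeriv] at hzero ⊢
    fun_prop
  | more n ih₀ ih₁ =>
    simp only [schrodingerKernelDeriv]
    fun_prop

/-- Differentiation of `∫ K x y g(y) dy` over a compact interval, for a jointly continuous
kernel `K` with jointly continuous derivative and an integrable density `g`. -/
lemma hasDerivAt_setIntegral_mul_of_continuousOn {𝕜 : Type*} [RCLike 𝕜] [NormedAlgebra 𝕜 ℂ]
    {K K' : 𝕜 → ℝ → ℂ} {g : ℝ → ℂ} {a b ε : ℝ} {x₀ : 𝕜} (hε : 0 < ε)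
    (hg : IntegrableOn g (Ioo a b))
    (hK : ContinuousOn (fun p : 𝕜 × ℝ => K p.1 p.2) (Metric.closedBall x₀ ε ×ˢ Icc a b))
    (hK' : ContinuousOn (fun p : 𝕜 × ℝ => K' p.1 p.2) (Metric.closedBall x₀ ε ×ˢ Icc a b))
    (hderiv : ∀ x ∈ Metric.closedBall x₀ ε, ∀ y, HasDerivAt (K · y) (K' x y) x) :
    HasDerivAt (fun x => ∫ y in Ioo a b, K x y * g y) (∫ y in Ioo a b, K' x₀ y * g y) x₀ := by
  have hslice : ∀ {L : 𝕜 → ℝ → ℂ},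
      ContinuousOn (fun p : 𝕜 × ℝ => L p.1 p.2) (Metric.closedBall x₀ ε ×ˢ Icc a b) →
      ∀ x ∈ Metric.closedBall x₀ ε, ContinuousOn (L x) (Icc a b) := fun hL x hx =>
    hL.comp (f := fun y => (x, y)) (by fun_prop) fun y hy => ⟨hx, hy⟩
  have hmeas : ∀ {L : 𝕜 → ℝ → ℂ},
      ContinuousOn (fun p : 𝕜 × ℝ => L p.1 p.2) (Metric.closedBall x₀ ε ×ˢ Icc a b) →
      ∀ x ∈ Metric.closedBall x₀ ε,
        AEStronglyMeasurable (fun y => L x y * g y) (volume.restrict (Ioo a b)) :=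
    fun hL x hx => (((hslice hL x hx).mono Ioo_subset_Icc_self).aestronglyMeasurable
      measurableSet_Ioo).mul hg.aestronglyMeasurable
  have hball : Metric.closedBall x₀ ε ∈ nhds x₀ := Metric.closedBall_mem_nhds x₀ hε
  have hx₀ : x₀ ∈ Metric.closedBall x₀ ε := Metric.mem_closedBall_self hε.le
  obtain ⟨C, hC⟩ :=
    ((isCompact_closedBall x₀ ε).prod isCompact_Icc).exists_bound_of_continuousOn hK'
  obtain ⟨C₀, hC₀⟩ := isCompact_Icc.exists_bound_of_continuousOn (hslice hK x₀ hx₀)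
  refine (hasDerivAt_integral_of_dominated_loc_of_deriv_le (s := Metric.closedBall x₀ ε)
    (F' := fun x y => K' x y * g y) (bound := fun y => C * ‖g y‖) hball ?_ ?_
    (hmeas hK' x₀ hx₀) ?_ (hg.norm.const_mul C) ?_).2
  · filter_upwards [hball] with x hx using hmeas hK x hx
  · refine (hg.norm.const_mul C₀).mono' (hmeas hK x₀ hx₀) ?_
    filter_upwards [ae_restrict_mem measurableSet_Ioo] with y hy
    rw [norm_mul]
    gcongr
    exact hC₀ y (Ioo_subset_Icc_self hy)
  · filter_upwards [ae_restrict_mem measurableSet_Ioo] with y hy x hx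
    rw [norm_mul]
    gcongr
    exact hC (x, y) ⟨hx, Ioo_subset_Icc_self hy⟩
  · exact Eventually.of_forall fun y x hx => (hderiv x hx y).mul_const (g y)

/-- The convolution over `(-1, 1)` of a density with the `n`-th spatial derivative of the
Schrödinger kernel. -/
noncomputable def schrodingerPotential (g : ℝ → ℂ) (n : ℕ) (t : ℝ) (z : ℂ) : ℂ :=
  ∫ y in Ioo (-1 : ℝ) 1, schrodingerKernelDeriv n t (z - y) * g y

lemma hasDerivAt_schrodingerPotential_space {g : ℝ → ℂ} (hg : IntegrableOn g (Ioo (-1) 1))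
    {t : ℝ} (ht : 0 < t) (n : ℕ) (z : ℂ) :
    HasDerivAt (schrodingerPotential g n t) (schrodingerPotential g (n + 1) t z) z := by
  have hcont : ∀ m : ℕ, ContinuousOn
      (fun p : ℂ × ℝ => schrodingerKernelDeriv m t (p.1 - p.2))
      (Metric.closedBall z 1 ×ˢ Icc (-1) 1) := fun m =>
    (continuousOn_schrodingerKernelDeriv m).comp (f := fun p : ℂ × ℝ => (t, p.1 - (p.2 : ℂ)))
      (by fun_prop) fun p _ => ⟨ht, mem_univ _⟩
  exact hasDerivAt_setIntegral_mul_of_continuousOn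
    (K := fun x y => schrodingerKernelDeriv n t (x - y))
    (K' := fun x y => schrodingerKernelDeriv (n + 1) t (x - y)) one_pos hg (hcont n)
    (hcont (n + 1)) fun x _ y =>
      (hasDerivAt_schrodingerKernelDeriv_space ht n (x - y)).comp_sub_const x (y : ℂ)

lemma hasDerivAt_schrodingerPotential_time {g : ℝ → ℂ} (hg : IntegrableOn g (Ioo (-1) 1))
    {t : ℝ} (ht : 0 < t) (n : ℕ) (z : ℂ) :
    HasDerivAt (fun s => schrodingerPotential g n s z)
      (Complex.I * schrodingerPotential g (n + 2) t z) t := by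
  have hpos : ∀ s ∈ Metric.closedBall t (t / 2), 0 < s := fun s hs => by
    rw [Real.closedBall_eq_Icc] at hs
    linarith [hs.1]
  have hcont : ∀ m : ℕ, ContinuousOn
      (fun p : ℝ × ℝ => schrodingerKernelDeriv m p.1 (z - p.2))
      (Metric.closedBall t (t / 2) ×ˢ Icc (-1) 1) := fun m =>
    (continuousOn_schrodingerKernelDeriv m).comp (f := fun p : ℝ × ℝ => (p.1, z - (p.2 : ℂ)))
      (by fun_prop) fun p hp => ⟨hpos _ hp.1, mem_univ _⟩
  refine (hasDerivAt_setIntegral_mul_of_continuousOn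
    (K := fun s y => schrodingerKernelDeriv n s (z - y))
    (K' := fun s y => Complex.I * schrodingerKernelDeriv (n + 2) s (z - y)) (half_pos ht) hg
    (hcont n) (continuousOn_const.mul (hcont (n + 2)))
    fun s hs y => hasDerivAt_schrodingerKernelDeriv_time (hpos s hs) n (z - y)).congr_deriv ?_
  simp only [schrodingerPotential, mul_assoc, integral_const_mul]

lemma iteratedDeriv_schrodingerPotential_space {g : ℝ → ℂ} (hg : IntegrableOn g (Ioo (-1) 1))
    {t : ℝ} (ht : 0 < t) (n : ℕ) :
    iteratedDeriv n (schrodingerPotential g 0 t) = schrodingerPotential g n t := by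
  induction n with
  | zero => exact iteratedDeriv_zero
  | succ n ih =>
    rw [iteratedDeriv_succ, ih]
    exact funext fun z => (hasDerivAt_schrodingerPotential_space hg ht n z).deriv

lemma iteratedDeriv_schrodingerPotential_time {g : ℝ → ℂ} (hg : IntegrableOn g (Ioo (-1) 1))
    (n : ℕ) (z : ℂ) (j : ℕ) {t : ℝ} (ht : 0 < t) :
    iteratedDeriv j (fun s => schrodingerPotential g n s z) t =
      Complex.I ^ j * schrodingerPotential g (n + 2 * j) t z := by
  induction j generalizing t with
  | zero => simp
  | succ j ih =>
    have hev : iteratedDeriv j (fun s => schrodingerPotential g n s z) =ᶠ[nhds t]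
        fun s => Complex.I ^ j * schrodingerPotential g (n + 2 * j) s z := by
      filter_upwards [Ioi_mem_nhds ht] with s hs using ih hs
    rw [iteratedDeriv_succ, hev.deriv_eq,
      ((hasDerivAt_schrodingerPotential_time hg ht (n + 2 * j) z).const_mul _).deriv, pow_succ,
      mul_assoc]
    rfl

/-- Spatial derivatives of even order vanish at the origin for an odd density. -/
lemma schrodingerPotential_even_zero {g : ℝ → ℂ} (hodd : ∀ y, g (-y) = -g y) (n : ℕ) (t : ℝ) :
    schrodingerPotential g (2 * n) t 0 = 0 := by
  have hneg : schrodingerPotential g (2 * n) t 0 = -schrodingerPotential g (2 * n) t 0 := by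
    simp only [schrodingerPotential]
    rw [← integral_neg]
    have h := (Measure.measurePreserving_neg (volume : Measure ℝ)).setIntegral_preimage_emb
      (MeasurableEquiv.neg ℝ).measurableEmbedding
      (fun y => schrodingerKernelDeriv (2 * n) t (0 - y) * g y) (Ioo (-1) 1)
    rw [← h]
    simp [hodd, schrodingerKernelDeriv_neg]
  exact self_eq_neg.mp hneg

lemma thetaOdd_neg (θ₀ : ℝ → ℂ) (y : ℝ) : thetaOdd θ₀ (-y) = -thetaOdd θ₀ y := by
  simp only [thetaOdd, neg_neg]
  split_ifs <;> grind

lemma integrable_thetaOdd {θ₀ : ℝ → ℂ} (hθ₀ : IntegrableOn θ₀ (Ioo 0 1)) :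
    Integrable (thetaOdd θ₀) := by
  have h : Integrable ((Ioo (0 : ℝ) 1).indicator θ₀) :=
    (integrable_indicator_iff measurableSet_Ioo).mpr hθ₀
  convert h.sub h.comp_neg using 1
  funext y
  simp only [thetaOdd, Pi.sub_apply, indicator, mem_Ioo]
  split_ifs <;> grind

lemma thetaMinus_eq_schrodingerPotential (θ₀ : ℝ → ℂ) (t x : ℝ) :
    thetaMinus θ₀ t x = schrodingerPotential (thetaOdd θ₀) 0 t x := by
  simp only [thetaMinus, schrodingerPotential, ← schrodingerKernelDeriv_zero_ofReal,
    Complex.ofReal_sub]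

theorem stmt11 (θ₀ : ℝ → ℂ)
    (hθ₀ : MeasureTheory.MemLp θ₀ 2 (MeasureTheory.volume.restrict (Set.Ioo (0 : ℝ) 1))) :
    -- θ⁻(t,x) = Σ_{j≥0} (-i)^j x^{2j+1}/(2j+1)! ⬝ ∂_t^j (∂_x θ⁻)(t,0), as a convergent sum
    ∀ t : ℝ, 0 < t → ∀ x ∈ Set.Icc (0 : ℝ) 1,
      HasSum
        (fun j : ℕ => (-Complex.I) ^ j * (x : ℂ) ^ (2 * j + 1) / ((2 * j + 1).factorial : ℂ) *
          iteratedDeriv j (fun t' => deriv (fun x' => thetaMinus θ₀ t' x') 0) t)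
        (thetaMinus θ₀ t x) := by
  intro t ht x _
  have hg : IntegrableOn (thetaOdd θ₀) (Ioo (-1) 1) :=
    (integrable_thetaOdd (hθ₀.integrable one_le_two)).integrableOn
  have htime : ∀ j : ℕ, iteratedDeriv j (fun t' => deriv (fun x' => thetaMinus θ₀ t' x') 0) t =
      Complex.I ^ j * schrodingerPotential (thetaOdd θ₀) (1 + 2 * j) t 0 := fun j => by
    rw [← iteratedDeriv_schrodingerPotential_time hg 1 0 j ht]
    refine Filter.EventuallyEq.iteratedDeriv_eq j ?_
    filter_upwards [Ioi_mem_nhds ht] with s hs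
    simp only [thetaMinus_eq_schrodingerPotential]
    have h := hasDerivAt_schrodingerPotential_space hg hs 0 ((0 : ℝ) : ℂ)
    simpa using h.comp_ofReal.deriv
  have htaylor := Complex.hasSum_taylorSeries_of_entire
    (fun z => (hasDerivAt_schrodingerPotential_space hg ht 0 z).differentiableAt) 0 (x : ℂ)
  simp only [iteratedDeriv_schrodingerPotential_space hg ht, sub_zero, smul_eq_mul,
    ← thetaMinus_eq_schrodingerPotential] at htaylor
  have hinj : Function.Injective fun j : ℕ => 2 * j + 1 := fun i j h => by grind
  rw [← hinj.hasSum_iff] at htaylor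
  · refine (congrArg (HasSum · _) (funext fun j => ?_)).mpr htaylor
    have hI : (-Complex.I) ^ j * Complex.I ^ j = 1 := by simp [← mul_pow]
    simp only [Function.comp_apply, htime, add_comm 1 (2 * j)]
    linear_combination (x : ℂ) ^ (2 * j + 1) / ((2 * j + 1).factorial : ℂ) *
      schrodingerPotential (thetaOdd θ₀) (2 * j + 1) t 0 * hI
  · intro n hn
    rcases Nat.even_or_odd' n with ⟨k, rfl | rfl⟩
    · simp [schrodingerPotential_even_zero (thetaOdd_neg θ₀)]
    · exact absurd ⟨k, rfl⟩ hn
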